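/- arXiv:2508.18678 — 6 statements merged into one kernel-verified Lean document; each statement's English description precedes it below -/
import Mathlib

section
/- Let n ≥ 1 and let ε : {1,…,n} → {1,−1}. Let V be a finite set of integer vectors in ℤⁿ. Assume the following unimodularity condition (condition (H) of the paper): for every choice of n vectors u₁,…,uₙ (repetitions allowed) from the set V ∪ {−ε(i)·eᵢ : 1 ≤ i ≤ n} (where eᵢ is the i-th standard basis vector), the determinant of the n×n integer matrix with columns u₁,…,uₙ lies in {0, 1, −1}. Define P := {x ∈ ℝⁿ : ε(i)·xᵢ ≥ 0 for all i, and ⟨x, v⟩ := Σᵢ vᵢ·xᵢ ≤ 1 for all v ∈ V}. Then every extreme point of the convex set P has all coordinates in ℤ. -/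
lemma aux_eventually (c e b : ℝ) (hc : c ≤ b) (he : c = b → e = 0) :
    ∀ᶠ t in nhds (0:ℝ), c + t * e ≤ b := by
  rcases hc.lt_or_eq with h | h
  · have hcont : Continuous (fun t : ℝ => c + t * e) := by fun_prop
    have := hcont.tendsto 0
    simp only [zero_mul, add_zero] at this
    exact (this.eventually (gt_mem_nhds h)).mono fun t ht => ht.le
  · have := he h
    subst this
    simp [hc]

lemma aux_span {n : ℕ} (T : Set (Fin n → ℤ))
    (hT : ∀ d : Fin n → ℝ, (∀ w ∈ T, ∑ i, (w i : ℝ) * d i = 0) → d = 0) :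
    ∃ u : Fin n → (Fin n → ℤ), (∀ j, u j ∈ T) ∧
      LinearIndependent ℝ (fun j => (fun i => (u j i : ℝ))) := by
  let v : T → (Fin n → ℝ) := fun w i => (w.1 i : ℝ)
  have hspan : Submodule.span ℝ (Set.range v) = ⊤ := by
    by_contra hne
    obtain ⟨f, hf0, hf⟩ := Submodule.exists_le_ker_of_lt_top _ (lt_top_iff_ne_top.2 hne)
    apply hf0
    have hfe : ∀ y : Fin n → ℝ, f y = ∑ i, y i * f (Pi.single i 1) := by
      intro y
      rw [LinearMap.pi_apply_eq_sum_univ f y]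
      refine Finset.sum_congr rfl fun i _ => ?_
      rw [smul_eq_mul]
      congr 2
      ext j
      simp [Pi.single_apply, eq_comm]
    have hd := hT (fun i => f (Pi.single i 1)) (by
      intro w hw
      have h1 : v ⟨w, hw⟩ ∈ LinearMap.ker f := hf (Submodule.subset_span ⟨_, rfl⟩)
      rw [LinearMap.mem_ker, hfe] at h1
      exact h1)
    ext1
    ext
    simpa using congrFun hd _
  obtain ⟨κ, a, ha, hsp, hli⟩ := exists_linearIndependent' ℝ v
  let B := Module.Basis.mk hli (by rw [hsp, hspan])
  let e : κ ≃ Fin n := B.indexEquiv (Pi.basisFun ℝ (Fin n))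
  exact ⟨fun j => (a (e.symm j)).1, fun j => (a (e.symm j)).2, hli.comp e.symm e.symm.injective⟩

/-- If all n×n determinants formed from column vectors taken from
`V ∪ {-ε i • eᵢ}` lie in `{0, 1, -1}`, then every extreme point of the region
`P = {x : ε i * x i ≥ 0 ∀ i, ⟨x, v⟩ ≤ 1 ∀ v ∈ V}` has integer coordinates. -/
theorem extreme_points_integral
    (n : ℕ) (hn : 1 ≤ n) (ε : Fin n → ℤ) (hε : ∀ i, ε i = 1 ∨ ε i = -1)
    (V : Finset (Fin n → ℤ))
    (hH : ∀ u : Fin n → (Fin n → ℤ),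
      (∀ j, u j ∈ V ∨ ∃ i : Fin n, u j = Pi.single i (-(ε i))) →
      Matrix.det (Matrix.of fun i j => u j i) ∈ ({0, 1, -1} : Set ℤ))
    (P : Set (Fin n → ℝ))
    (hP : P = {x : Fin n → ℝ |
      (∀ i, 0 ≤ (ε i : ℝ) * x i) ∧ ∀ v ∈ V, (∑ i, (v i : ℝ) * x i) ≤ 1}) :
    ∀ x ∈ P.extremePoints ℝ, ∀ i, ∃ m : ℤ, x i = (m : ℝ) := by
  intro x hx
  subst hP
  obtain ⟨⟨hx1, hx2⟩, hext⟩ := mem_extremePoints_iff_left.1 hx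
  let T : Set (Fin n → ℤ) := {w | (w ∈ V ∧ ∑ i, (w i : ℝ) * x i = 1) ∨
    ∃ i, w = Pi.single i (-(ε i)) ∧ x i = 0}
  have hT : ∀ d : Fin n → ℝ, (∀ w ∈ T, ∑ i, (w i : ℝ) * d i = 0) → d = 0 := by
    intro d hd
    have hεr : ∀ i, (ε i : ℝ) ≠ 0 := by
      intro i
      rcases hε i with h | h <;> simp [h]
    have hdi : ∀ i, x i = 0 → d i = 0 := by
      intro i hi
      have := hd _ (Or.inr ⟨i, rfl, hi⟩)
      rw [Finset.sum_eq_single i] at this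
      · simpa [hεr i, (by exact_mod_cast hεr i : ε i ≠ 0)] using this
      · intro j _ hj
        simp [Pi.single_apply, hj]
      · simp
    have hev : ∀ᶠ t in nhds (0:ℝ), (x + t • d) ∈ {x : Fin n → ℝ |
      (∀ i, 0 ≤ (ε i : ℝ) * x i) ∧ ∀ v ∈ V, (∑ i, (v i : ℝ) * x i) ≤ 1} := by
      have h1 : ∀ᶠ t in nhds (0:ℝ), ∀ i, 0 ≤ (ε i : ℝ) * (x + t • d) i := by
        rw [Filter.eventually_all]
        intro i
        have := aux_eventually (-((ε i : ℝ) * x i)) (-((ε i : ℝ) * d i)) 0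
          (by linarith [hx1 i]) (by
            intro h
            have : x i = 0 := by simpa [hεr i] using h
            simp [hdi i this])
        filter_upwards [this] with t ht
        simp only [Pi.add_apply, Pi.smul_apply, smul_eq_mul]
        linarith
      have h2 : ∀ᶠ t in nhds (0:ℝ), ∀ v ∈ V, (∑ i, (v i : ℝ) * (x + t • d) i) ≤ 1 := by
        rw [Filter.eventually_all_finset]
        intro v hv
        have := aux_eventually (∑ i, (v i : ℝ) * x i) (∑ i, (v i : ℝ) * d i) 1 (hx2 v hv)
          (fun h => hd v (Or.inl ⟨hv, h⟩))
        filter_upwards [this] with t ht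
        convert ht using 1
        rw [Finset.mul_sum, ← Finset.sum_add_distrib]
        refine Finset.sum_congr rfl fun i _ => ?_
        simp only [Pi.add_apply, Pi.smul_apply, smul_eq_mul]
        ring
      exact h1.and h2
    obtain ⟨δ, hδ, hball⟩ := Metric.eventually_nhds_iff.1 hev
    have hp := hball (y := δ / 2) (by
      rw [Real.dist_eq, sub_zero, abs_of_pos (by linarith)]; linarith)
    have hm := hball (y := -(δ / 2)) (by
      rw [Real.dist_eq, sub_zero, abs_neg, abs_of_pos (by linarith)]; linarith)
    have key := hext _ hp _ hm ⟨1/2, 1/2, by norm_num, by norm_num, by norm_num, by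
      ext i
      simp only [Pi.add_apply, Pi.smul_apply, smul_eq_mul]
      ring⟩
    have h0 : (δ / 2) • d = 0 := by simpa using key
    exact (smul_eq_zero.1 h0).resolve_left (by linarith)
  obtain ⟨u, huT, hli⟩ := aux_span T hT
  let A : Matrix (Fin n) (Fin n) ℤ := Matrix.of u
  have hdet := hH u (fun j => (huT j).imp (fun h => h.1) (fun ⟨i, h⟩ => ⟨i, h.1⟩))
  have hA : Matrix.det (Matrix.of fun i j => u j i) = A.det := Matrix.det_transpose A
  rw [hA] at hdet
  have hne : A.det ≠ 0 := by
    have h1 : IsUnit (A.map (Int.cast : ℤ → ℝ)) :=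
      Matrix.linearIndependent_rows_iff_isUnit.1 hli
    have h2 := ((Matrix.isUnit_iff_isUnit_det _).1 h1).ne_zero
    intro h
    apply h2
    have h3 := (Int.castRingHom ℝ).map_det A
    rw [h] at h3
    simpa using h3.symm
  have hu : IsUnit A.det := by
    rw [Int.isUnit_iff]
    simp only [Set.mem_insert_iff, Set.mem_singleton_iff] at hdet
    exact hdet.resolve_left hne
  have hb : ∀ j, ∃ m : ℤ, ∑ i, (A j i : ℝ) * x i = m := by
    intro j
    rcases huT j with h | ⟨i, h, hi⟩
    · exact ⟨1, by simpa [A] using h.2⟩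
    · refine ⟨0, ?_⟩
      rw [Int.cast_zero]
      refine Finset.sum_eq_zero fun k _ => ?_
      by_cases hk : k = i
      · simp [hk, hi]
      · simp [A, h, hk]
  choose b hb using hb
  intro i
  refine ⟨∑ j, A⁻¹ i j * b j, ?_⟩
  have hinv := Matrix.nonsing_inv_mul A hu
  have hmap : (A⁻¹.map (Int.cast : ℤ → ℝ)) * (A.map (Int.cast : ℤ → ℝ)) = 1 := by
    have := congrArg (fun M => (Int.castRingHom ℝ).mapMatrix M) hinv
    simp only [map_mul, map_one] at this
    exact this
  have hAx : (A.map (Int.cast : ℤ → ℝ)).mulVec x = fun j => (b j : ℝ) := by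
    ext j
    rw [← hb j]
    rfl
  have hfin : x = (A⁻¹.map (Int.cast : ℤ → ℝ)).mulVec (fun j => (b j : ℝ)) := by
    rw [← hAx, Matrix.mulVec_mulVec, hmap, Matrix.one_mulVec]
  rw [hfin]
  simp [Matrix.mulVec, dotProduct]
end

section
/- Let A be an associative unital (possibly noncommutative) ring, let e₁, e₂ ∈ A be orthogonal idempotents, let x ∈ e₁Ae₂ and u ∈ e₁Ae₁. Suppose that for all p, q ∈ e₁Ae₂ there exist a ∈ e₁Ae₁ and b, b′ ∈ e₂Ae₂ with p = a·x + x·b and q = a·u·x + x·b′. Then every element of e₁Ae₁ can be written as l + l′·u with l, l′ ∈ L_x; that is, e₁Ae₁ = L_x + L_x·u. -/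
/-- `Lx e₁ e₂ x` is the set L_x = {a ∈ e₁Ae₁ : a·x ∈ xAe₂}, where
xAe₂ = {x·c·e₂ : c ∈ A}. -/
def Lx {A : Type*} [Ring A] (e₁ e₂ x : A) : Set A :=
  {a | e₁ * a * e₁ = a ∧ ∃ c, a * x = x * c * e₂}

/-- implication (c) ⇒ (b) of Proposition 5.2:
if every pair p, q ∈ e₁Ae₂ can be written p = a·x + x·b, q = a·u·x + x·b′,
then e₁Ae₁ = L_x + L_x·u. -/
theorem corner_eq_Lx_add_Lx_mul {A : Type*} [Ring A] (e₁ e₂ x u : A)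
    (he₁ : IsIdempotentElem e₁) (he₂ : IsIdempotentElem e₂)
    (horth₁ : e₁ * e₂ = 0) (horth₂ : e₂ * e₁ = 0)
    (hx : e₁ * x * e₂ = x) (hu : e₁ * u * e₁ = u)
    (hyp : ∀ p q : A, e₁ * p * e₂ = p → e₁ * q * e₂ = q →
      ∃ a b b' : A, e₁ * a * e₁ = a ∧ e₂ * b * e₂ = b ∧ e₂ * b' * e₂ = b' ∧
        p = a * x + x * b ∧ q = a * u * x + x * b') :
    ∀ c : A, e₁ * c * e₁ = c →
      ∃ l l' : A, l ∈ Lx e₁ e₂ x ∧ l' ∈ Lx e₁ e₂ x ∧ c = l + l' * u := by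
  intro c hc
  have hl : ∀ y : A, e₁ * y * e₁ = y → e₁ * y = y := fun y hy => by
    rw [← hy, ← mul_assoc, ← mul_assoc, he₁.eq]
  have hr : ∀ y : A, e₁ * y * e₁ = y → y * e₁ = y := fun y hy => by
    rw [← hy, mul_assoc, he₁.eq]
  have hxr : x * e₂ = x := by rw [← hx, mul_assoc, he₂.eq]
  have hq : e₁ * (c * x) * e₂ = c * x := by
    rw [← mul_assoc, hl c hc, mul_assoc, hxr]
  obtain ⟨a, b, b', ha, hb, hb', h1, h2⟩ := hyp 0 (c * x) (by simp) hq
  have hbr : b * e₂ = b := by rw [← hb, mul_assoc, he₂.eq]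
  have hbr' : b' * e₂ = b' := by rw [← hb', mul_assoc, he₂.eq]
  refine ⟨c - a * u, a, ⟨?_, b', ?_⟩, ⟨ha, -b, ?_⟩, by simp⟩
  · rw [mul_sub, sub_mul, hc, ← mul_assoc, hl a ha, mul_assoc, hr u hu]
  · rw [sub_mul, h2, mul_assoc x, hbr']
    abel
  · rw [mul_assoc x, neg_mul, hbr, mul_neg]
    exact eq_neg_of_add_eq_zero_left h1.symm
end

section
/- Let A be an associative unital (possibly noncommutative) ring, let e₁, e₂ ∈ A be orthogonal idempotents, let x ∈ e₁Ae₂ and u ∈ e₂Ae₂. Suppose that for all p, q ∈ e₁Ae₂ there exist a ∈ e₂Ae₂ and b, b′ ∈ e₁Ae₁ with p = x·a + b·x and q = x·u·a + b′·x. Then every element of e₂Ae₂ can be written as r + u·r′ with r, r′ ∈ R_x; that is, e₂Ae₂ = R_x + u·R_x. -/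
/-- `Rx e₁ e₂ x` is the set R_x = {a ∈ e₂Ae₂ : x·a ∈ e₁Ax}, where
e₁Ax = {e₁·c·x : c ∈ A}. -/
def Rx {A : Type*} [Ring A] (e₁ e₂ x : A) : Set A :=
  {a | e₂ * a * e₂ = a ∧ ∃ c, x * a = e₁ * c * x}

/-- implication (c) ⇒ (b) of Proposition 5.3:
if every pair p, q ∈ e₁Ae₂ can be written p = x·a + b·x, q = x·u·a + b′·x,
then e₂Ae₂ = R_x + u·R_x. -/
theorem corner_eq_Rx_add_mul_Rx {A : Type*} [Ring A] (e₁ e₂ x u : A)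
    (he₁ : IsIdempotentElem e₁) (he₂ : IsIdempotentElem e₂)
    (horth₁ : e₁ * e₂ = 0) (horth₂ : e₂ * e₁ = 0)
    (hx : e₁ * x * e₂ = x) (hu : e₂ * u * e₂ = u)
    (hyp : ∀ p q : A, e₁ * p * e₂ = p → e₁ * q * e₂ = q →
      ∃ a b b' : A, e₂ * a * e₂ = a ∧ e₁ * b * e₁ = b ∧ e₁ * b' * e₁ = b' ∧
        p = x * a + b * x ∧ q = x * u * a + b' * x) :
    ∀ c : A, e₂ * c * e₂ = c →
      ∃ r r' : A, r ∈ Rx e₁ e₂ x ∧ r' ∈ Rx e₁ e₂ x ∧ c = r + u * r' := by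
  intro c hc
  have h1 : e₁ * x = x := by
    rw [← hx]; simp only [← mul_assoc]; rw [he₁.eq]
  have h2 : c * e₂ = c := by
    rw [← hc]; simp only [mul_assoc]; rw [he₂.eq]
  have h3 : e₂ * u = u := by
    rw [← hu]; simp only [← mul_assoc]; rw [he₂.eq]
  obtain ⟨a, b, b', ha, hb, hb', hp, hq⟩ := hyp 0 (x * c) (by simp)
    (by rw [← mul_assoc, h1, mul_assoc, h2])
  have h4 : a * e₂ = a := by
    rw [← ha]; simp only [mul_assoc]; rw [he₂.eq]
  have k : ∀ d : A, e₁ * d * x = e₁ * d * e₁ * x := fun d => by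
    rw [mul_assoc (e₁ * d), h1]
  refine ⟨c - u * a, a, ⟨?_, b', ?_⟩, ⟨ha, -b, ?_⟩, by abel⟩
  · rw [mul_sub, sub_mul, hc, ← mul_assoc, h3, mul_assoc, h4]
  · rw [k, hb', mul_sub, hq, mul_assoc]; abel
  · rw [k, mul_neg, neg_mul, hb, neg_mul]
    exact eq_neg_of_add_eq_zero_left hp.symm
end

section
/- Let A be an associative unital (possibly noncommutative) ring and let e₁, e₂, e₃ ∈ A be pairwise orthogonal idempotents. Let x ∈ e₁Ae₂, x* ∈ e₂Ae₁, y ∈ e₂Ae₃, t ∈ e₂Ae₂, v ∈ e₂Ae₂, and set z* := x·t·y. Assume: (1) x is a right generator of e₁Ae₂, i.e. xAe₂ = e₁Ae₂; (2) x* is a right generator of e₂Ae₁, i.e. x*Ae₁ = e₂Ae₁; (3) every element of e₂Ae₂ can be written as l + l′·v with l, l′ ∈ L_y; (4) every element of e₂Ae₃ can be written as m + c·z* with m ∈ yAe₃ and c ∈ e₂Ae₁. Then there exists ℓ₂ ∈ e₂Ae₂ such that every element of e₂Ae₂ can be written as l + l′·(x*·x·ℓ₂) with l, l′ ∈ L_y;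 that is, e₂Ae₂ = L_y + L_y·x*·x·ℓ₂. -/
/-- `Ly e₂ e₃ y` is the set L_y = {a ∈ e₂Ae₂ : a·y ∈ yAe₃}, where
yAe₃ = {y·c·e₃ : c ∈ A}. -/
def Ly {A : Type*} [Ring A] (e₂ e₃ y : A) : Set A :=
  {a | e₂ * a * e₂ = a ∧ ∃ c, a * y = y * c * e₃}

/-- Lemma 5.9 of the paper: there exists ℓ₂ ∈ e₂Ae₂ with
e₂Ae₂ = L_y + L_y·x*·x·ℓ₂. -/
theorem exists_ell_two {A : Type*} [Ring A] (e₁ e₂ e₃ x xs y t v : A)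
    (he₁ : IsIdempotentElem e₁) (he₂ : IsIdempotentElem e₂)
    (he₃ : IsIdempotentElem e₃)
    (h12 : e₁ * e₂ = 0) (h21 : e₂ * e₁ = 0)
    (h13 : e₁ * e₃ = 0) (h31 : e₃ * e₁ = 0)
    (h23 : e₂ * e₃ = 0) (h32 : e₃ * e₂ = 0)
    (hx : e₁ * x * e₂ = x) (hxs : e₂ * xs * e₁ = xs)
    (hy : e₂ * y * e₃ = y) (ht : e₂ * t * e₂ = t) (hv : e₂ * v * e₂ = v)
    -- (1) x is a right generator of e₁Ae₂ : xAe₂ = e₁Ae₂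
    (hgen_x : {a : A | ∃ c, a = x * c * e₂} = {a : A | ∃ c, a = e₁ * c * e₂})
    -- (2) x* is a right generator of e₂Ae₁ : x*Ae₁ = e₂Ae₁
    (hgen_xs : {a : A | ∃ c, a = xs * c * e₁} = {a : A | ∃ c, a = e₂ * c * e₁})
    -- (3) e₂Ae₂ = L_y + L_y·v
    (h3 : ∀ c : A, e₂ * c * e₂ = c →
      ∃ l l' : A, l ∈ Ly e₂ e₃ y ∧ l' ∈ Ly e₂ e₃ y ∧ c = l + l' * v)
    -- (4) e₂Ae₃ = yAe₃ + (e₂Ae₁)·z*, where z* = x·t·y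
    (h4 : ∀ c : A, e₂ * c * e₃ = c →
      ∃ m d : A, (∃ c', m = y * c' * e₃) ∧ e₂ * d * e₁ = d ∧
        c = m + d * (x * t * y)) :
    ∃ ℓ₂ : A, e₂ * ℓ₂ * e₂ = ℓ₂ ∧
      ∀ c : A, e₂ * c * e₂ = c →
        ∃ l l' : A, l ∈ Ly e₂ e₃ y ∧ l' ∈ Ly e₂ e₃ y ∧
          c = l + l' * (xs * x * ℓ₂) := by
  have e22 : e₂ * e₂ = e₂ := he₂
  have e11 : e₁ * e₁ = e₁ := he₁
  have e33 : e₃ * e₃ = e₃ := he₃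
  have xr : x * e₂ = x := by rw [← hx, mul_assoc, e22]
  have yl : e₂ * y = y := by rw [← hy, ← mul_assoc, ← mul_assoc, e22]
  have yr : y * e₃ = y := by rw [← hy, mul_assoc, e33]
  have xsl : e₂ * xs = xs := by rw [← hxs, ← mul_assoc, ← mul_assoc, e22]
  have xsr : xs * e₁ = xs := by rw [← hxs, mul_assoc, e11]
  have tr : t * e₂ = t := by rw [← ht, mul_assoc, e22]
  have hvy : e₂ * (v * y) * e₃ = v * y := by
    have vl : e₂ * v = v := by rw [← hv, ← mul_assoc, ← mul_assoc, e22]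
    rw [← mul_assoc, vl, mul_assoc, yr]
  obtain ⟨m, d, ⟨c', hm⟩, hd, hvd⟩ := h4 _ hvy
  have hd' : d ∈ {a : A | ∃ c, a = e₂ * c * e₁} := ⟨d, hd.symm⟩
  rw [← hgen_xs] at hd'
  obtain ⟨p, hp⟩ := hd'
  have hq : e₁ * (p * e₁ * x * t) * e₂ ∈ {a : A | ∃ c, a = e₁ * c * e₂} := ⟨_, rfl⟩
  rw [← hgen_x] at hq
  obtain ⟨u, hu⟩ := hq
  have key : xs * x * (e₂ * u * e₂) = d * x * t := by
    calc xs * x * (e₂ * u * e₂) = xs * ((x * e₂) * u * e₂) := by simp only [mul_assoc]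
      _ = xs * (x * u * e₂) := by rw [xr]
      _ = (xs * e₁) * p * e₁ * x * (t * e₂) := by rw [← hu]; simp only [mul_assoc]
      _ = d * x * t := by rw [xsr, tr, hp]
  have hl : e₂ * (e₂ * u * e₂) * e₂ = e₂ * u * e₂ := by
    calc _ = (e₂ * e₂) * u * (e₂ * e₂) := by simp only [mul_assoc]
      _ = _ := by rw [e22]
  refine ⟨e₂ * u * e₂, hl, fun c hc => ?_⟩
  rw [key]
  have hdx : e₂ * (d * x * t) * e₂ = d * x * t := by
    rw [← key]
    calc _ = (e₂ * xs) * x * (e₂ * u * (e₂ * e₂)) := by simp only [mul_assoc]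
      _ = _ := by rw [xsl, e22]
  have hwy : (v - d * x * t) * y = y * c' * e₃ := by
    rw [sub_mul, hvd, ← hm]; simp only [mul_assoc]; abel
  obtain ⟨l, l', ⟨hl1, a, ha⟩, ⟨hl'1, b, hb⟩, hcl⟩ := h3 c hc
  have l'l : e₂ * l' = l' := by rw [← hl'1, ← mul_assoc, ← mul_assoc, e22]
  have wr : (v - d * x * t) * e₂ = v - d * x * t := by
    rw [sub_mul, ← hdx, ← hv]; simp only [mul_assoc, e22]
  refine ⟨l + l' * (v - d * x * t), l', ⟨?_, a + b * e₃ * c', ?_⟩, ⟨hl'1, b, hb⟩, ?_⟩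
  · rw [mul_add, add_mul, hl1, ← mul_assoc, l'l, mul_assoc, wr]
  · rw [add_mul, mul_assoc l', hwy, ha, ← mul_assoc, ← mul_assoc, hb, mul_add, add_mul]
    simp only [mul_assoc]
  · rw [hcl, mul_sub]; abel
end

section
/- Let A be an associative unital (possibly noncommutative) ring, let e₁, e₂ ∈ A be orthogonal idempotents, and let x ∈ e₁Ae₂. Assume x is a right generator of e₁Ae₂ but not a left generator, i.e. xAe₂ = e₁Ae₂ and e₁Ax ≠ e₁Ae₂. Let R_x := {a ∈ e₂Ae₂ : x·a ∈ e₁Ax}, let n ∈ e₂Ae₂ be a nilpotent element, and let w ∈ e₂Ae₂. Suppose that every element of e₂Ae₂ can be written as r + n·w·r′ with r, r′ ∈ R_x. Then n ∉ R_x. -/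
/-- Lemma 5.5(b) of the paper: if x is a right but not a left
generator of e₁Ae₂, n ∈ e₂Ae₂ is nilpotent, and e₂Ae₂ = R_x + n·w·R_x, then
n ∉ R_x. -/
theorem nilpotent_not_mem_Rx {A : Type*} [Ring A] (e₁ e₂ x n w : A)
    (he₁ : IsIdempotentElem e₁) (he₂ : IsIdempotentElem e₂)
    (horth₁ : e₁ * e₂ = 0) (horth₂ : e₂ * e₁ = 0)
    (hx : e₁ * x * e₂ = x)
    -- x is a right generator of e₁Ae₂ : xAe₂ = e₁Ae₂
    (hright : {a : A | ∃ c, a = x * c * e₂} = {a : A | ∃ c, a = e₁ * c * e₂})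
    -- x is not a left generator : e₁Ax ≠ e₁Ae₂
    (hnotleft : {a : A | ∃ c, a = e₁ * c * x} ≠ {a : A | ∃ c, a = e₁ * c * e₂})
    (hn : e₂ * n * e₂ = n) (hnil : IsNilpotent n) (hw : e₂ * w * e₂ = w)
    -- e₂Ae₂ = R_x + n·w·R_x
    (hyp : ∀ c : A, e₂ * c * e₂ = c →
      ∃ r r' : A, r ∈ Rx e₁ e₂ x ∧ r' ∈ Rx e₁ e₂ x ∧ c = r + n * w * r') :
    n ∉ Rx e₁ e₂ x := by
  have e1x : e₁ * x = x := by
    calc e₁ * x = e₁ * (e₁ * x * e₂) := by rw [hx]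
      _ = (e₁ * e₁) * x * e₂ := by simp only [mul_assoc]
      _ = x := by rw [he₁.eq, hx]
  have xe2 : x * e₂ = x := by
    calc x * e₂ = (e₁ * x * e₂) * e₂ := by rw [hx]
      _ = e₁ * x * (e₂ * e₂) := by simp only [mul_assoc]
      _ = x := by rw [he₂.eq, hx]
  have key : ∀ a : A, e₂ * a * e₂ = a → e₂ * a = a ∧ a * e₂ = a := by
    intro a ha
    constructor
    · calc e₂ * a = e₂ * (e₂ * a * e₂) := by rw [ha]
        _ = (e₂ * e₂) * a * e₂ := by simp only [mul_assoc]
        _ = a := by rw [he₂.eq, ha]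
    · calc a * e₂ = (e₂ * a * e₂) * e₂ := by rw [ha]
        _ = e₂ * a * (e₂ * e₂) := by simp only [mul_assoc]
        _ = a := by rw [he₂.eq, ha]
  have hadd : ∀ a b : A, a ∈ Rx e₁ e₂ x → b ∈ Rx e₁ e₂ x → a + b ∈ Rx e₁ e₂ x := by
    rintro a b ⟨ha, c, hc⟩ ⟨hb, d, hd⟩
    refine ⟨by rw [mul_add, add_mul, ha, hb], c + d, ?_⟩
    rw [mul_add, hc, hd, mul_add, add_mul]
  have hmul : ∀ a b : A, a ∈ Rx e₁ e₂ x → b ∈ Rx e₁ e₂ x → a * b ∈ Rx e₁ e₂ x := by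
    rintro a b ⟨ha, c, hc⟩ ⟨hb, d, hd⟩
    refine ⟨?_, c * e₁ * d, ?_⟩
    · rw [← mul_assoc, (key a ha).1, mul_assoc, (key b hb).2]
    · rw [← mul_assoc, hc, mul_assoc, hd]
      simp only [mul_assoc]
  intro hnR
  obtain ⟨r, r', hr, hr', hwr⟩ := hyp w hw
  have hit : ∀ k : ℕ, ∃ p q : A, p ∈ Rx e₁ e₂ x ∧ w = p + n ^ k * w * q := by
    intro k
    induction k with
    | zero => exact ⟨0, 1, ⟨by simp, 0, by simp⟩, by simp⟩
    | succ k ih =>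
      obtain ⟨p, q, hp, hpq⟩ := ih
      refine ⟨r + n * p * r', q * r', hadd _ _ hr (hmul _ _ (hmul _ _ hnR hp) hr'), ?_⟩
      calc w = r + n * w * r' := hwr
        _ = r + n * (p + n ^ k * w * q) * r' := by rw [← hpq]
        _ = _ := by rw [pow_succ']; noncomm_ring
  obtain ⟨k, hk⟩ := hnil
  obtain ⟨p, q, hp, hpq⟩ := hit k
  have hwR : w ∈ Rx e₁ e₂ x := by
    rw [hk, zero_mul, zero_mul, add_zero] at hpq
    rw [hpq]; exact hp
  apply hnotleft
  ext a
  constructor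
  · rintro ⟨c, rfl⟩
    exact ⟨c * x, by rw [mul_assoc, mul_assoc, mul_assoc, xe2]⟩
  · intro ha
    rw [← hright] at ha
    obtain ⟨c, rfl⟩ := ha
    have hc : e₂ * (e₂ * c * e₂) * e₂ = e₂ * c * e₂ := by
      calc _ = (e₂ * e₂) * c * (e₂ * e₂) := by simp only [mul_assoc]
        _ = _ := by rw [he₂.eq]
    obtain ⟨s, s', hs, hs', h⟩ := hyp _ hc
    have hR : e₂ * c * e₂ ∈ Rx e₁ e₂ x := by
      rw [h]; exact hadd _ _ hs (hmul _ _ (hmul _ _ hnR hwR) hs')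
    obtain ⟨-, d, hd⟩ := hR
    refine ⟨d, ?_⟩
    rw [← hd, ← mul_assoc, ← mul_assoc, xe2]
end

section
/- Every extreme point of the convex set P := {x ∈ ℝ³ : x₁ ≥ 0, x₂ ≤ 0, x₃ ≥ 0, x₁ + x₂ + x₃ ≤ 1, −x₂ − x₃ ≤ 1, x₃ ≤ 1, x₁ − x₃ ≤ 1} has all coordinates in ℤ; consequently P equals the convex hull of the finite set {(0,0,0), (1,0,0), (1,−1,0), (0,−1,0), (0,−2,1), (0,−1,1), (0,0,1), (1,−1,1), (1,−2,1), (2,−2,1)}. -/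
theorem four_mem_aux {s : Set (ℝ × ℝ × ℝ)} (hs : Convex ℝ s) {p q r t x : ℝ × ℝ × ℝ}
    (hp : p ∈ s) (hq : q ∈ s) (hr : r ∈ s) (ht : t ∈ s) (a b c d : ℝ)
    (ha : 0 ≤ a) (hb : 0 ≤ b) (hc : 0 ≤ c) (hd : 0 ≤ d) (h : a + b + c + d = 1)
    (hx : a • p + b • q + c • r + d • t = x) : x ∈ s := by
  have := hs.sum_mem (t := Finset.univ) (w := ![a, b, c, d]) (z := ![p, q, r, t])
    (by intro i _; fin_cases i <;> simpa)
    (by simpa [Fin.sum_univ_four] using h)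
    (by intro i _; fin_cases i <;> simpa)
  simpa [Fin.sum_univ_four, hx] using this

/-- every extreme point of the region P (case d(12)) has integer
coordinates, and P is the convex hull of the listed ten lattice points. -/
theorem region_d12_integral_vertices (P : Set (ℝ × ℝ × ℝ))
    (hP : P = {x : ℝ × ℝ × ℝ | 0 ≤ x.1 ∧ x.2.1 ≤ 0 ∧ 0 ≤ x.2.2 ∧
      x.1 + x.2.1 + x.2.2 ≤ 1 ∧ -x.2.1 - x.2.2 ≤ 1 ∧ x.2.2 ≤ 1 ∧
      x.1 - x.2.2 ≤ 1}) :
    (∀ x ∈ P.extremePoints ℝ,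
      (∃ m : ℤ, x.1 = (m : ℝ)) ∧ (∃ m : ℤ, x.2.1 = (m : ℝ)) ∧
        (∃ m : ℤ, x.2.2 = (m : ℝ))) ∧
    P = convexHull ℝ
      ({(0, 0, 0), (1, 0, 0), (1, -1, 0), (0, -1, 0), (0, -2, 1), (0, -1, 1),
        (0, 0, 1), (1, -1, 1), (1, -2, 1), (2, -2, 1)} : Set (ℝ × ℝ × ℝ)) := by
  have key : P = convexHull ℝ
      ({(0, 0, 0), (1, 0, 0), (1, -1, 0), (0, -1, 0), (0, -2, 1), (0, -1, 1),
        (0, 0, 1), (1, -1, 1), (1, -2, 1), (2, -2, 1)} : Set (ℝ × ℝ × ℝ)) := by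
    apply Set.Subset.antisymm
    · rw [hP]
      rintro ⟨x, y, z⟩ ⟨h1, h2, h3, h4, h5, h6, h7⟩
      simp only at h1 h2 h3 h4 h5 h6 h7
      generalize hV : ({(0, 0, 0), (1, 0, 0), (1, -1, 0), (0, -1, 0), (0, -2, 1), (0, -1, 1),
        (0, 0, 1), (1, -1, 1), (1, -2, 1), (2, -2, 1)} : Set (ℝ × ℝ × ℝ)) = V
      have hc : Convex ℝ (convexHull ℝ V) := convex_convexHull ℝ V
      have hO : ((0, 0, 0) : ℝ × ℝ × ℝ) ∈ convexHull ℝ V :=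
        subset_convexHull ℝ V (by rw [← hV]; simp)
      have hA : ((1, 0, 0) : ℝ × ℝ × ℝ) ∈ convexHull ℝ V :=
        subset_convexHull ℝ V (by rw [← hV]; simp)
      have hB : ((1, -1, 0) : ℝ × ℝ × ℝ) ∈ convexHull ℝ V :=
        subset_convexHull ℝ V (by rw [← hV]; simp)
      have hC : ((0, -1, 0) : ℝ × ℝ × ℝ) ∈ convexHull ℝ V :=
        subset_convexHull ℝ V (by rw [← hV]; simp)
      have hD : ((0, 0, 1) : ℝ × ℝ × ℝ) ∈ convexHull ℝ V :=
        subset_convexHull ℝ V (by rw [← hV]; simp)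
      have hE : ((0, -2, 1) : ℝ × ℝ × ℝ) ∈ convexHull ℝ V :=
        subset_convexHull ℝ V (by rw [← hV]; simp)
      have hF : ((2, -2, 1) : ℝ × ℝ × ℝ) ∈ convexHull ℝ V :=
        subset_convexHull ℝ V (by rw [← hV]; simp)
      by_cases c1 : 0 ≤ 1 + y - x - z
      · refine four_mem_aux hc hC hO hA hD (-y) (1 + y - x - z) x z ?_ ?_ ?_ ?_ ?_ ?_ <;>
          first | linarith | (ext <;> simp <;> ring)
      by_cases c2 : 0 ≤ x - y - 3 * z - 1
      · refine four_mem_aux hc hC hA hB hF (1 + z - x) (1 + y + z) (x - y - 3 * z - 1) z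
          ?_ ?_ ?_ ?_ ?_ ?_ <;>
          first | linarith | (ext <;> simp <;> ring)
      by_cases c3 : 0 ≤ z - 1 - x - y
      · refine four_mem_aux hc hC hD hE hF (1 - z) ((z + y + 1) / 2) ((z - 1 - x - y) / 2) (x / 2)
          ?_ ?_ ?_ ?_ ?_ ?_ <;>
          first | linarith | (ext <;> simp <;> ring)
      · refine four_mem_aux hc hC hA hD hF ((1 - x - y - z) / 2) ((x + y - z + 1) / 2)
          ((3 * z - x + y + 1) / 4) ((x - y + z - 1) / 4) ?_ ?_ ?_ ?_ ?_ ?_ <;>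
          first | linarith | (ext <;> simp <;> ring)
    · apply convexHull_min
      · rw [hP]
        intro p hp
        simp only [Set.mem_insert_iff, Set.mem_singleton_iff] at hp
        rcases hp with h | h | h | h | h | h | h | h | h | h <;> subst h <;> norm_num
      · rw [hP]
        rintro ⟨x, y, z⟩ ⟨h1, h2, h3, h4, h5, h6, h7⟩ ⟨u, v, w⟩ ⟨g1, g2, g3, g4, g5, g6, g7⟩
          a b ha hb hab
        simp only at h1 h2 h3 h4 h5 h6 h7 g1 g2 g3 g4 g5 g6 g7
        have hb' : b = 1 - a := by linarith
        simp only [Set.mem_setOf_eq, Prod.smul_mk, Prod.mk_add_mk, smul_eq_mul]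
        refine ⟨?_, ?_, ?_, ?_, ?_, ?_, ?_⟩
        · linarith [mul_le_mul_of_nonneg_left h1 ha, mul_le_mul_of_nonneg_left g1 hb]
        · linarith [mul_le_mul_of_nonneg_left h2 ha, mul_le_mul_of_nonneg_left g2 hb]
        · linarith [mul_le_mul_of_nonneg_left h3 ha, mul_le_mul_of_nonneg_left g3 hb]
        · linarith [mul_le_mul_of_nonneg_left h4 ha, mul_le_mul_of_nonneg_left g4 hb]
        · linarith [mul_le_mul_of_nonneg_left h5 ha, mul_le_mul_of_nonneg_left g5 hb]
        · linarith [mul_le_mul_of_nonneg_left h6 ha, mul_le_mul_of_nonneg_left g6 hb]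
        · linarith [mul_le_mul_of_nonneg_left h7 ha, mul_le_mul_of_nonneg_left g7 hb]
  refine ⟨?_, key⟩
  intro p hp
  rw [key] at hp
  have hp := extremePoints_convexHull_subset hp
  simp only [Set.mem_insert_iff, Set.mem_singleton_iff] at hp
  have i0 : ∃ m : ℤ, (0 : ℝ) = m := ⟨0, by norm_num⟩
  have i1 : ∃ m : ℤ, (1 : ℝ) = m := ⟨1, by norm_num⟩
  have i2 : ∃ m : ℤ, (2 : ℝ) = m := ⟨2, by norm_num⟩
  have j1 : ∃ m : ℤ, (-1 : ℝ) = m := ⟨-1, by norm_num⟩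
  have j2 : ∃ m : ℤ, (-2 : ℝ) = m := ⟨-2, by norm_num⟩
  rcases hp with h | h | h | h | h | h | h | h | h | h <;> subst h <;>
    refine ⟨?_, ?_, ?_⟩ <;> assumption
end
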